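/- Let m ≥ 1 be a natural number, a an integer, y an element of B_a, and n a natural number large enough that the ball B_{−n}(y) := {z ∈ ℚ_p : |z − y| ≤ p^{−n}} is contained in B_a. Then for all positive real numbers t_1, …, t_{m+1}, with z_0 := 0, the iterated integral satisfies the strict inequality: ∫_{B_a} ⋯ ∫_{B_a} ∫_{B_{−n}(y)} ρ(t_{m+1}, z − z_m) · ∏_{i=1}^m ρ(t_i, z_i − z_{i−1}) dμ(z) dμ(z_m) ⋯ dμ(z_1) > (∫_{B_{−n}(y)} ρ(t_1 + ⋯ + t_m + t_{m+1}, z) dμ(z)) · ∏_{i=1}^m ∫_{B_a} ρ(t_i, z_i) dμ(z_i). -/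

import Mathlib

open MeasureTheory

/-- The fundamental solution `ρ(t,x)` of the p-adic diffusion equation with diffusion
constant `σ` and Vladimirov exponent `b`:
`ρ(t,x) = Σ_{r∈ℤ} (exp(−σ t p^{rb}) − exp(−σ t p^{(r+1)b})) p^r 1_{B_{−r}}(x)`. -/
noncomputable def rho (p : ℕ) [Fact p.Prime] (σ b : ℝ) (t : ℝ) (x : ℚ_[p]) : ℝ :=
  ∑' r : ℤ,
    (Real.exp (-(σ * t * (p : ℝ) ^ ((r : ℝ) * b))) -
      Real.exp (-(σ * t * (p : ℝ) ^ (((r : ℝ) + 1) * b)))) *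
    (p : ℝ) ^ (r : ℤ) *
    Set.indicator {y : ℚ_[p] | ‖y‖ ≤ (p : ℝ) ^ (-r : ℤ)} (fun _ => 1) x

/-- The iterated integral `∫_A ρ(t_1, x_1−x_0) ∫_A ρ(t_2, x_2−x_1) ⋯ ∫_A ρ(t_k, x_k−x_{k−1})
· f(x_k) dμ(x_k) ⋯ dμ(x_1)`, defined by recursion on the list `(t_1,…,t_k)` of time
increments; `f` is the innermost factor and `x0` the starting point. -/
noncomputable def iterInt (p : ℕ) [Fact p.Prime] [MeasurableSpace ℚ_[p]]
    (σ b : ℝ) (μ : MeasureTheory.Measure ℚ_[p]) (A : Set ℚ_[p]) (f : ℚ_[p] → ℝ) :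
    List ℝ → ℚ_[p] → ℝ
  | [], x0 => f x0
  | t :: ts, x0 => ∫ x in A, rho p σ b t (x - x0) * iterInt p σ b μ A f ts x ∂μ

/-- The ball of radius `p ^ r` about `c` in `ℚ_p`. -/
abbrev padicBall (p : ℕ) [Fact p.Prime] (c : ℚ_[p]) (r : ℤ) : Set ℚ_[p] :=
  {x | ‖x - c‖ ≤ (p : ℝ) ^ r}

section Balls

variable {p : ℕ} [Fact p.Prime]

lemma one_lt_cast_prime (p : ℕ) [hp : Fact p.Prime] : (1 : ℝ) < p := by
  exact_mod_cast hp.out.one_lt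

lemma padicBall_eq_closedBall (c : ℚ_[p]) (r : ℤ) :
    padicBall p c r = Metric.closedBall c ((p : ℝ) ^ r) := by
  ext x
  simp [dist_eq_norm]

lemma measurableSet_padicBall [MeasurableSpace ℚ_[p]] [BorelSpace ℚ_[p]] (c : ℚ_[p]) (r : ℤ) :
    MeasurableSet (padicBall p c r) := by
  rw [padicBall_eq_closedBall]
  exact Metric.isClosed_closedBall.measurableSet

lemma padicBall_eq_of_mem {c d : ℚ_[p]} {r : ℤ} (h : d ∈ padicBall p c r) :
    padicBall p d r = padicBall p c r := by
  rw [padicBall_eq_closedBall] at *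
  rw [padicBall_eq_closedBall, IsUltrametricDist.closedBall_eq_of_mem h]

lemma padicBall_subset {r s : ℤ} (h : r ≤ s) (c : ℚ_[p]) :
    padicBall p c r ⊆ padicBall p c s := fun _ hx =>
  le_trans hx (zpow_le_zpow_right₀ (one_lt_cast_prime p).le h)

lemma exists_digit {u : ℚ_[p]} (hu : ‖u‖ ≤ 1) :
    ∃ i < p, ‖u - (i : ℚ_[p])‖ ≤ (p : ℝ) ^ (-1 : ℤ) := by
  obtain ⟨v, rfl⟩ : ∃ v : ℤ_[p], (v : ℚ_[p]) = u := ⟨⟨u, hu⟩, rfl⟩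
  refine ⟨v.zmodRepr, v.zmodRepr_lt_p, ?_⟩
  rw [Padic.norm_le_pow_iff_norm_lt_pow_add_one]
  simpa [PadicInt.norm_def] using v.norm_sub_zmodRepr_lt_one

lemma eq_of_norm_natCast_sub_lt_one {i j : ℕ} (hi : i < p) (hj : j < p)
    (h : ‖(i : ℚ_[p]) - j‖ < 1) : i = j := by
  have h' : ‖((i - j : ℤ) : ℚ_[p])‖ < 1 := by push_cast; exact h
  rw [Padic.norm_intCast_lt_one_iff, ← Int.modEq_iff_dvd, Int.natCast_modEq_iff] at h'
  exact (Nat.ModEq.eq_of_lt_of_lt h' hj hi).symm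

lemma mem_padicBall_digit_iff (x : ℚ_[p]) (i : ℕ) (r : ℤ) :
    x ∈ padicBall p ((i : ℚ_[p]) * (p : ℚ_[p]) ^ (-(r + 1))) r ↔
      ‖x * (p : ℚ_[p]) ^ (r + 1) - i‖ ≤ (p : ℝ) ^ (-1 : ℤ) := by
  have hp0 : (p : ℝ) ≠ 0 := (zero_lt_one.trans (one_lt_cast_prime p)).ne'
  have hq0 : (p : ℚ_[p]) ≠ 0 := by exact_mod_cast (Fact.out : p.Prime).ne_zero
  have hpos : (0 : ℝ) < (p : ℝ) ^ (r + 1) := zpow_pos (zero_lt_one.trans (one_lt_cast_prime p)) _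
  have hx : x - (i : ℚ_[p]) * (p : ℚ_[p]) ^ (-(r + 1)) =
      (x * (p : ℚ_[p]) ^ (r + 1) - i) * (p : ℚ_[p]) ^ (-(r + 1)) := by
    rw [sub_mul, mul_assoc, ← zpow_add₀ hq0]
    simp
  have hr : (p : ℝ) ^ r = (p : ℝ) ^ (-1 : ℤ) * (p : ℝ) ^ (r + 1) := by
    rw [← zpow_add₀ hp0]; congr 1; ring
  change ‖_‖ ≤ _ ↔ _
  rw [hx, norm_mul, Padic.norm_p_zpow, neg_neg, hr, mul_le_mul_iff_left₀ hpos]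

lemma padicBall_succ (r : ℤ) :
    padicBall p 0 (r + 1) =
      ⋃ i ∈ Finset.range p, padicBall p ((i : ℚ_[p]) * (p : ℚ_[p]) ^ (-(r + 1))) r := by
  have hpos : (0 : ℝ) < (p : ℝ) ^ (r + 1) := zpow_pos (zero_lt_one.trans (one_lt_cast_prime p)) _
  ext x
  simp only [Set.mem_iUnion, Finset.mem_range, exists_prop, mem_padicBall_digit_iff]
  simp only [Set.mem_ofPred_eq, sub_zero]
  constructor
  · intro hx
    apply exists_digit
    rw [norm_mul, Padic.norm_p_zpow, zpow_neg]
    exact mul_inv_le_one_of_le₀ hx hpos.le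
  · rintro ⟨i, -, hi⟩
    have h1 : ‖x * (p : ℚ_[p]) ^ (r + 1)‖ ≤ 1 := by
      rw [← sub_add_cancel (x * (p : ℚ_[p]) ^ (r + 1)) (i : ℚ_[p])]
      refine (IsUltrametricDist.norm_add_le_max _ _).trans (max_le (hi.trans ?_) ?_)
      · exact zpow_le_one_of_nonpos₀ (one_lt_cast_prime p).le (by norm_num)
      · exact_mod_cast Padic.norm_int_le_one (p := p) i
    rwa [norm_mul, Padic.norm_p_zpow, zpow_neg, mul_inv_le_iff₀ hpos, one_mul] at h1

variable [MeasurableSpace ℚ_[p]] [BorelSpace ℚ_[p]]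
  (μ : Measure ℚ_[p]) [μ.IsAddHaarMeasure]

lemma measure_padicBall_center (c : ℚ_[p]) (r : ℤ) :
    μ (padicBall p c r) = μ (padicBall p 0 r) := by
  have : padicBall p c r = (fun x => x + -c) ⁻¹' padicBall p 0 r := by
    ext x
    simp [sub_eq_add_neg]
  rw [this, measure_preimage_add_right]

lemma measure_padicBall_succ (r : ℤ) :
    μ (padicBall p 0 (r + 1)) = p * μ (padicBall p 0 r) := by
  rw [padicBall_succ, measure_biUnion_finset _ fun i _ => measurableSet_padicBall _ _]
  · simp [measure_padicBall_center]
  · intro i hi j hj hij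
    rw [Function.onFun, Set.disjoint_left]
    intro x hx hx'
    rw [mem_padicBall_digit_iff, Padic.norm_le_pow_iff_norm_lt_pow_add_one] at hx hx'
    refine hij (eq_of_norm_natCast_sub_lt_one (p := p) (by simpa using hi) (by simpa using hj) ?_)
    rw [← sub_sub_sub_cancel_left _ _ (x * (p : ℚ_[p]) ^ (r + 1))]
    rw [sub_eq_add_neg]
    refine (IsUltrametricDist.norm_add_le_max _ _).trans_lt (max_lt ?_ ?_)
    · simpa using hx'
    · rw [norm_neg]
      simpa using hx

lemma measure_padicBall (hμ : μ (padicBall p 0 0) = 1) (c : ℚ_[p]) (r : ℤ) :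
    μ (padicBall p c r) = ENNReal.ofReal ((p : ℝ) ^ r) := by
  have hp := one_lt_cast_prime p
  have hp0 : (p : ℝ) ≠ 0 := by positivity
  have hE : ENNReal.ofReal (p : ℝ) = p := ENNReal.ofReal_natCast p
  rw [measure_padicBall_center]
  induction r using Int.induction_on with
  | zero => simpa using hμ
  | succ k ih =>
    rw [measure_padicBall_succ, ih, zpow_add_one₀ hp0, mul_comm,
      ENNReal.ofReal_mul (by positivity), hE]
  | pred k ih =>
    have h := measure_padicBall_succ μ (-(k : ℤ) - 1)
    rw [sub_add_cancel, ih, show -(k : ℤ) = -(k : ℤ) - 1 + 1 by ring, zpow_add_one₀ hp0, mul_comm,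
      ENNReal.ofReal_mul (by positivity), hE, sub_add_cancel] at h
    refine ((ENNReal.mul_right_inj ?_ ?_).1 h).symm
    · exact_mod_cast (Fact.out : p.Prime).ne_zero
    · simp

end Balls

section Decay

/-- The decay factor `exp (-σ t p ^ (r b))`: the total weight that the representation of
`rho` as a mixture of uniform laws on balls puts on the balls `B_{-s}` with `s ≥ r`. -/
noncomputable def decay (p : ℕ) (σ b t : ℝ) (r : ℤ) : ℝ :=
  Real.exp (-(σ * t * (p : ℝ) ^ ((r : ℝ) * b)))

variable {p : ℕ} {σ b : ℝ}

lemma decay_add (s t : ℝ) (r : ℤ) : decay p σ b (s + t) r = decay p σ b s r * decay p σ b t r := by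
  rw [decay, decay, decay, ← Real.exp_add]
  ring_nf

lemma decay_le_one (hσ : 0 < σ) {t : ℝ} (ht : 0 < t) (r : ℤ) : decay p σ b t r ≤ 1 := by
  rw [decay, Real.exp_le_one_iff, neg_nonpos]
  positivity

variable [Fact p.Prime]

lemma decay_antitone (hσ : 0 < σ) (hb : 0 < b) {t : ℝ} (ht : 0 < t) :
    Antitone (decay p σ b t) := by
  intro r s hrs
  have hp := one_lt_cast_prime p
  have : (r : ℝ) ≤ s := by exact_mod_cast hrs
  unfold decay
  gcongr
  exact hp.le

lemma tendsto_decay_atTop (hσ : 0 < σ) (hb : 0 < b) {t : ℝ} (ht : 0 < t) (r : ℤ) :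
    Filter.Tendsto (fun k : ℕ => decay p σ b t (r + k)) Filter.atTop (nhds 0) := by
  have hp := one_lt_cast_prime p
  refine Real.tendsto_exp_neg_atTop_nhds_zero.comp ?_
  refine Filter.Tendsto.const_mul_atTop (by positivity) ?_
  refine (tendsto_rpow_atTop_of_base_gt_one _ hp).comp ?_
  refine Filter.Tendsto.atTop_mul_const hb ?_
  push_cast
  exact Filter.tendsto_atTop_add_const_left _ _ tendsto_natCast_atTop_atTop

lemma hasSum_decay_tail (hσ : 0 < σ) (hb : 0 < b) {t : ℝ} (ht : 0 < t) (r : ℤ) :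
    HasSum (fun s : ℤ => if r ≤ s then decay p σ b t s - decay p σ b t (s + 1) else 0)
      (decay p σ b t r) := by
  have hinj : Function.Injective fun k : ℕ => r + (k : ℤ) := fun i j h => by
    simpa using h
  rw [← hinj.hasSum_iff]
  · rw [hasSum_iff_tendsto_nat_of_nonneg]
    · have h : ∀ N : ℕ, ∑ k ∈ Finset.range N, ((fun s : ℤ =>
          if r ≤ s then decay p σ b t s - decay p σ b t (s + 1) else 0) ∘
            fun k : ℕ => r + (k : ℤ)) k = decay p σ b t r - decay p σ b t (r + N) := by
        intro N
        have := Finset.sum_range_sub' (fun k : ℕ => decay p σ b t (r + k)) N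
        simpa [add_assoc] using this
      simp_rw [h]
      simpa using (tendsto_decay_atTop hσ hb ht r).const_sub (decay p σ b t r)
    · intro k
      simpa [add_assoc] using decay_antitone (p := p) hσ hb ht (by lia : r + (k : ℤ) ≤ r + (k + 1))
  · intro s hs
    rw [if_neg]
    intro h
    exact hs ⟨(s - r).toNat, by dsimp only; lia⟩

lemma decay_sub_nonneg (hσ : 0 < σ) (hb : 0 < b) {t : ℝ} (ht : 0 < t) (s : ℤ) :
    0 ≤ decay p σ b t s - decay p σ b t (s + 1) :=
  sub_nonneg.2 (decay_antitone hσ hb ht (by lia))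

lemma sum_decay_sub_le_one (hσ : 0 < σ) (hb : 0 < b) {t : ℝ} (ht : 0 < t) (u : Finset ℤ) :
    ∑ s ∈ u, (decay p σ b t s - decay p σ b t (s + 1)) ≤ 1 := by
  obtain ⟨r, hr⟩ := u.bddBelow
  refine le_trans ?_ (decay_le_one (p := p) (b := b) hσ ht r)
  refine le_trans (le_of_eq (Finset.sum_congr rfl fun s hs => ?_))
    (sum_le_hasSum u (fun s _ => ?_) (hasSum_decay_tail hσ hb ht r))
  · rw [if_pos (hr hs)]
  · split_ifs
    exacts [decay_sub_nonneg hσ hb ht s, le_rfl]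

lemma summable_decay_sub (hσ : 0 < σ) (hb : 0 < b) {t : ℝ} (ht : 0 < t) :
    Summable fun s : ℤ => decay p σ b t s - decay p σ b t (s + 1) :=
  summable_of_sum_le (decay_sub_nonneg hσ hb ht) (sum_decay_sub_le_one hσ hb ht)

lemma tsum_decay_sub_le_one (hσ : 0 < σ) (hb : 0 < b) {t : ℝ} (ht : 0 < t) :
    ∑' s : ℤ, (decay p σ b t s - decay p σ b t (s + 1)) ≤ 1 :=
  (summable_decay_sub hσ hb ht).tsum_le_of_sum_le (sum_decay_sub_le_one hσ hb ht)

end Decay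

section BallDensity

variable {p : ℕ} [Fact p.Prime]

/-- The density of the uniform probability law on `B_{-r}`. -/
noncomputable def ballDensity (p : ℕ) [Fact p.Prime] (r : ℤ) (x : ℚ_[p]) : ℝ :=
  (p : ℝ) ^ r * Set.indicator (padicBall p 0 (-r)) (fun _ => 1) x

lemma ballDensity_of_mem {r : ℤ} {x : ℚ_[p]} (h : x ∈ padicBall p 0 (-r)) :
    ballDensity p r x = (p : ℝ) ^ r := by
  rw [ballDensity, Set.indicator_of_mem h, mul_one]

lemma ballDensity_of_notMem {r : ℤ} {x : ℚ_[p]} (h : x ∉ padicBall p 0 (-r)) :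
    ballDensity p r x = 0 := by
  rw [ballDensity, Set.indicator_of_notMem h, mul_zero]

lemma ballDensity_nonneg (r : ℤ) (x : ℚ_[p]) : 0 ≤ ballDensity p r x :=
  mul_nonneg (by positivity) (Set.indicator_nonneg (fun _ _ => zero_le_one) x)

lemma ballDensity_le (r : ℤ) (x : ℚ_[p]) : ballDensity p r x ≤ (p : ℝ) ^ r := by
  by_cases h : x ∈ padicBall p 0 (-r)
  · exact (ballDensity_of_mem h).le
  · rw [ballDensity_of_notMem h]
    positivity

lemma zero_mem_padicBall (r : ℤ) : (0 : ℚ_[p]) ∈ padicBall p 0 r := by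
  simp only [padicBall, Set.mem_ofPred_eq, sub_self, norm_zero]
  positivity

lemma padicBall_inter_of_mem {c : ℚ_[p]} {r s : ℤ} (hrs : r ≤ s) (h : c ∈ padicBall p 0 s) :
    padicBall p 0 s ∩ padicBall p c r = padicBall p c r := by
  rw [← padicBall_eq_of_mem h]
  exact Set.inter_eq_right.2 (padicBall_subset hrs c)

lemma padicBall_inter_of_notMem {c : ℚ_[p]} {r s : ℤ} (hrs : r ≤ s) (h : c ∉ padicBall p 0 s) :
    padicBall p 0 s ∩ padicBall p c r = ∅ := by
  rw [Set.eq_empty_iff_forall_notMem]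
  rintro x ⟨hx0, hxc⟩
  rw [← padicBall_eq_of_mem hx0] at h
  apply h
  rw [padicBall_eq_of_mem (padicBall_subset hrs c hxc)]
  simp only [padicBall, Set.mem_ofPred_eq, sub_self, norm_zero]
  positivity

variable [MeasurableSpace ℚ_[p]] [BorelSpace ℚ_[p]]
  (μ : Measure ℚ_[p]) [μ.IsAddHaarMeasure]

lemma measureReal_padicBall (hμ : μ (padicBall p 0 0) = 1) (c : ℚ_[p]) (r : ℤ) :
    μ.real (padicBall p c r) = (p : ℝ) ^ r := by
  rw [measureReal_def, measure_padicBall μ hμ, ENNReal.toReal_ofReal (by positivity)]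

lemma measureReal_padicBall_inter (hμ : μ (padicBall p 0 0) = 1) (c : ℚ_[p]) (r s : ℤ) :
    (p : ℝ) ^ r * ((p : ℝ) ^ s * μ.real (padicBall p 0 (-s) ∩ padicBall p c (-r))) =
      ballDensity p (min r s) c := by
  have hp := one_lt_cast_prime p
  have hcancel : ∀ k : ℤ, (p : ℝ) ^ k * (p : ℝ) ^ (-k) = 1 := fun k => by
    rw [← zpow_add₀ (by positivity), add_neg_cancel, zpow_zero]
  rcases le_total r s with hrs | hrs
  · rw [min_eq_left hrs]
    by_cases h : c ∈ padicBall p 0 (-r)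
    · rw [ballDensity_of_mem h, padicBall_eq_of_mem h,
        Set.inter_eq_left.2 (padicBall_subset (by lia) 0),
        measureReal_padicBall μ hμ, hcancel, mul_one]
    · rw [ballDensity_of_notMem h]
      have := padicBall_inter_of_notMem (p := p) (le_refl (-r)) h
      rw [Set.subset_eq_empty (Set.inter_subset_inter_left _
        (padicBall_subset (by lia : -s ≤ -r) 0)) this]
      simp
  · rw [min_eq_right hrs]
    by_cases h : c ∈ padicBall p 0 (-s)
    · rw [ballDensity_of_mem h, padicBall_inter_of_mem (by lia) h, measureReal_padicBall μ hμ,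
        mul_left_comm, hcancel, mul_one]
    · rw [ballDensity_of_notMem h, padicBall_inter_of_notMem (by lia) h]
      simp

end BallDensity

section Average

variable {p : ℕ} [Fact p.Prime] {σ b : ℝ}

lemma rho_eq_tsum (t : ℝ) (x : ℚ_[p]) :
    rho p σ b t x =
      ∑' s : ℤ, (decay p σ b t s - decay p σ b t (s + 1)) * ballDensity p s x := by
  simp only [rho, decay, ballDensity, mul_assoc, padicBall, sub_zero, Int.cast_add, Int.cast_one]

variable [MeasurableSpace ℚ_[p]] {μ : Measure ℚ_[p]}

/-- The average of `rho p σ b t` over the ball of radius `p ^ (-r)` about `c`. -/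
noncomputable def rhoAverage (σ b : ℝ) (μ : Measure ℚ_[p]) (t : ℝ) (r : ℤ) (c : ℚ_[p]) : ℝ :=
  (p : ℝ) ^ r * ∫ z in padicBall p c (-r), rho p σ b t z ∂μ

lemma rhoAverage_of_mem {r : ℤ} {c : ℚ_[p]} (hc : c ∈ padicBall p 0 (-r)) (t : ℝ) :
    rhoAverage σ b μ t r c = rhoAverage σ b μ t r 0 := by
  rw [rhoAverage, rhoAverage, padicBall_eq_of_mem hc]

/-- The mass that `rho p σ b t` gives to the ball `B_{-r}`. -/
noncomputable def rhoMass (σ b : ℝ) (μ : Measure ℚ_[p]) (t : ℝ) (r : ℤ) : ℝ :=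
  ∫ z in padicBall p 0 (-r), rho p σ b t z ∂μ

lemma rhoMass_nonneg (t : ℝ) (hσ : 0 < σ) (hb : 0 < b) (ht : 0 < t) (r : ℤ) :
    0 ≤ rhoMass σ b μ t r := by
  refine integral_nonneg fun z => ?_
  rw [rho_eq_tsum]
  exact tsum_nonneg fun s => mul_nonneg (decay_sub_nonneg hσ hb ht s) (ballDensity_nonneg s z)

variable [BorelSpace ℚ_[p]] [μ.IsAddHaarMeasure]

lemma hasSum_rhoAverage (hμ : μ (padicBall p 0 0) = 1) (hσ : 0 < σ) (hb : 0 < b) {t : ℝ}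
    (ht : 0 < t) (r : ℤ) (c : ℚ_[p]) :
    HasSum (fun s : ℤ => (decay p σ b t s - decay p σ b t (s + 1)) * ballDensity p (min r s) c)
      (rhoAverage σ b μ t r c) := by
  have hp := one_lt_cast_prime p
  set w : ℤ → ℝ := fun s => decay p σ b t s - decay p σ b t (s + 1) with hw
  have hw0 : ∀ s, 0 ≤ w s := decay_sub_nonneg hσ hb ht
  have hfin : ∀ (c : ℚ_[p]) (r : ℤ), μ (padicBall p c r) ≠ ⊤ := fun c r => by
    simp [measure_padicBall μ hμ]
  have hint : ∀ s, IntegrableOn (ballDensity p s) (padicBall p c (-r)) μ := fun s => by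
    refine Integrable.const_mul ?_ _
    exact (integrableOn_const (hfin _ _)).indicator (measurableSet_padicBall _ _)
  have hval : ∀ s, ∫ z in padicBall p c (-r), ballDensity p s z ∂μ =
      (p : ℝ) ^ s * μ.real (padicBall p 0 (-s) ∩ padicBall p c (-r)) := fun s => by
    simp only [ballDensity]
    rw [integral_const_mul, integral_indicator (measurableSet_padicBall _ _), setIntegral_const,
      measureReal_restrict_apply (measurableSet_padicBall _ _), smul_eq_mul, mul_one]
  have hval' : ∀ s, ∫ z in padicBall p c (-r), ballDensity p s z ∂μ =
      (p : ℝ) ^ (-r) * ballDensity p (min r s) c := fun s => by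
    rw [hval, ← measureReal_padicBall_inter μ hμ, ← mul_assoc, ← zpow_add₀ (by positivity)]
    simp
  have hsum : Summable fun s => ∫ z in padicBall p c (-r), ‖w s * ballDensity p s z‖ ∂μ := by
    have : ∀ s z, ‖w s * ballDensity p s z‖ = w s * ballDensity p s z := fun s z =>
      Real.norm_of_nonneg (mul_nonneg (hw0 s) (ballDensity_nonneg s z))
    simp_rw [this, integral_const_mul, hval']
    refine Summable.of_nonneg_of_le (fun s => ?_) (fun s => ?_) (summable_decay_sub (p := p) hσ hb ht)
    · exact mul_nonneg (hw0 s) (mul_nonneg (by positivity) (ballDensity_nonneg (p := p) _ _))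
    · refine mul_le_of_le_one_right (hw0 s) ?_
      rw [zpow_neg, inv_mul_le_one₀ (by positivity)]
      exact (ballDensity_le _ _).trans (zpow_le_zpow_right₀ hp.le (min_le_left _ _))
  have key := hasSum_integral_of_summable_integral_norm (fun s => (hint s).const_mul (w s)) hsum
  simp_rw [integral_const_mul, hval', hw, ← rho_eq_tsum] at key
  refine (key.mul_left ((p : ℝ) ^ r)).congr_fun fun s => ?_
  rw [mul_left_comm, ← mul_assoc _ _ (ballDensity _ _ _), ← zpow_add₀ (by positivity)]
  simp

lemma rhoAverage_sub (hμ : μ (padicBall p 0 0) = 1) (hσ : 0 < σ) (hb : 0 < b) {t : ℝ}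
    (ht : 0 < t) (r : ℤ) (c : ℚ_[p]) :
    rhoAverage σ b μ t (r + 1) c - rhoAverage σ b μ t r c =
      decay p σ b t (r + 1) * (ballDensity p (r + 1) c - ballDensity p r c) := by
  have h1 := (hasSum_rhoAverage hμ hσ hb ht (r + 1) c).sub (hasSum_rhoAverage hμ hσ hb ht r c)
  have h2 := (hasSum_decay_tail (p := p) hσ hb ht (r + 1)).mul_right
    (ballDensity p (r + 1) c - ballDensity p r c)
  refine h1.unique (h2.congr_fun fun s => ?_)
  split_ifs with h
  · rw [min_eq_left h, min_eq_left (by lia), mul_sub]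
  · rw [min_eq_right (by lia), min_eq_right (by lia)]
    ring

lemma rhoMass_le_one (hμ : μ (padicBall p 0 0) = 1) (hσ : 0 < σ) (hb : 0 < b) {t : ℝ}
    (ht : 0 < t) (r : ℤ) : rhoMass σ b μ t r ≤ 1 := by
  have hp := one_lt_cast_prime p
  have h := hasSum_rhoAverage hμ hσ hb ht r 0
  have h' : rhoAverage σ b μ t r 0 ≤ (p : ℝ) ^ r * 1 := by
    refine le_trans ?_ (mul_le_mul_of_nonneg_left (tsum_decay_sub_le_one (p := p) hσ hb ht)
      (by positivity))
    refine hasSum_le (fun s => ?_) h ((summable_decay_sub hσ hb ht).hasSum.mul_left _)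
    rw [mul_comm]
    refine mul_le_mul_of_nonneg_right ?_ (decay_sub_nonneg hσ hb ht s)
    exact (ballDensity_le _ _).trans (zpow_le_zpow_right₀ hp.le (min_le_left _ _))
  exact le_of_mul_le_mul_left h' (by positivity)

lemma rhoMass_succ (hμ : μ (padicBall p 0 0) = 1) (hσ : 0 < σ) (hb : 0 < b) {t : ℝ}
    (ht : 0 < t) (r : ℤ) :
    rhoMass σ b μ t (r + 1) =
      (p : ℝ)⁻¹ * rhoMass σ b μ t r + (1 - (p : ℝ)⁻¹) * decay p σ b t (r + 1) := by
  have hp := one_lt_cast_prime p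
  have h := rhoAverage_sub hμ hσ hb ht r 0
  rw [ballDensity_of_mem (zero_mem_padicBall _), ballDensity_of_mem (zero_mem_padicBall _)] at h
  change (p : ℝ) ^ (r + 1) * rhoMass σ b μ t (r + 1) - (p : ℝ) ^ r * rhoMass σ b μ t r = _ at h
  rw [zpow_add_one₀ (by positivity)] at h
  have hr : (p : ℝ) ^ r ≠ 0 := by positivity
  have hp0 : (p : ℝ) ≠ 0 := by positivity
  field_simp
  apply mul_left_cancel₀ hr
  linear_combination h

lemma hasSum_rhoMass (hμ : μ (padicBall p 0 0) = 1) (hσ : 0 < σ) (hb : 0 < b) {t : ℝ}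
    (ht : 0 < t) (r : ℤ) :
    HasSum (fun k : ℕ => (1 - (p : ℝ)⁻¹) * (p : ℝ)⁻¹ ^ k * decay p σ b t (r - k))
      (rhoMass σ b μ t r) := by
  have hp := one_lt_cast_prime p
  have hq1 : (p : ℝ)⁻¹ < 1 := inv_lt_one_of_one_lt₀ hp
  have hq0 : 0 < (p : ℝ)⁻¹ := by positivity
  rw [hasSum_iff_tendsto_nat_of_nonneg]
  · have h : ∀ N : ℕ, ∑ k ∈ Finset.range N,
        (1 - (p : ℝ)⁻¹) * (p : ℝ)⁻¹ ^ k * decay p σ b t (r - k) =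
          rhoMass σ b μ t r - (p : ℝ)⁻¹ ^ N * rhoMass σ b μ t (r - N) := by
      intro N
      induction N with
      | zero => simp
      | succ N ih =>
        have := rhoMass_succ hμ hσ hb ht (r - ↑(N + 1))
        rw [show r - ((N + 1 : ℕ) : ℤ) + 1 = r - N by push_cast; ring] at this
        rw [Finset.sum_range_succ, ih, this, pow_succ]
        ring
    simp_rw [h]
    have hlim : Filter.Tendsto (fun N : ℕ => (p : ℝ)⁻¹ ^ N * rhoMass σ b μ t (r - N))
        Filter.atTop (nhds 0) := by
      refine squeeze_zero (fun N => ?_) (fun N => ?_)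
        (tendsto_pow_atTop_nhds_zero_of_lt_one hq0.le hq1)
      · exact mul_nonneg (by positivity) (rhoMass_nonneg t hσ hb ht _)
      · exact mul_le_of_le_one_right (by positivity) (rhoMass_le_one hμ hσ hb ht _)
    simpa using hlim.const_sub (rhoMass σ b μ t r)
  · intro k
    have : 0 ≤ decay p σ b t (r - k) := (Real.exp_pos _).le
    have : 0 ≤ 1 - (p : ℝ)⁻¹ := by linarith
    positivity

lemma rhoMass_pos (hμ : μ (padicBall p 0 0) = 1) (hσ : 0 < σ) (hb : 0 < b) {t : ℝ}
    (ht : 0 < t) (r : ℤ) : 0 < rhoMass σ b μ t r := by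
  have hp := one_lt_cast_prime p
  have hq1 : (p : ℝ)⁻¹ < 1 := inv_lt_one_of_one_lt₀ hp
  rw [← sub_add_cancel r 1, rhoMass_succ hμ hσ hb ht]
  have h0 := rhoMass_nonneg (μ := μ) t hσ hb ht (r - 1)
  have h1 : 0 < decay p σ b t (r - 1 + 1) := Real.exp_pos _
  have h2 : 0 < 1 - (p : ℝ)⁻¹ := by linarith
  positivity

lemma integrableOn_rho (hμ : μ (padicBall p 0 0) = 1) (hσ : 0 < σ) (hb : 0 < b) {t : ℝ}
    (ht : 0 < t) (r : ℤ) : IntegrableOn (rho p σ b t) (padicBall p 0 (-r)) μ := by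
  by_contra h
  exact (rhoMass_pos hμ hσ hb ht r).ne' (integral_undef h)

end Average

section Laplace

lemma exp_mul_le_affine {θ : ℝ} (h0 : 0 ≤ θ) (h1 : θ ≤ 1) (x : ℝ) :
    Real.exp (θ * x) ≤ (1 - θ) + θ * Real.exp x := by
  have := convexOn_exp.2 (Set.mem_univ 0) (Set.mem_univ x) (sub_nonneg.2 h1) h0 (by ring)
  simpa using this

variable {c l : ℕ → ℝ} {L : ℝ} {G : ℝ → ℝ}

lemma laplace_pos (hc : ∀ k, 0 < c k) {t : ℝ}
    (hG : HasSum (fun k => c k * Real.exp (-(t * l k))) (G t)) : 0 < G t := by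
  refine hasSum_lt (i := 0) (fun k => ?_) ?_ hasSum_zero hG
  · exact (mul_pos (hc k) (Real.exp_pos _)).le
  · exact mul_pos (hc 0) (Real.exp_pos _)

lemma laplace_lt_one (hc : ∀ k, 0 < c k) (hc1 : HasSum c 1) (hl : ∀ k, 0 < l k) {t : ℝ}
    (ht : 0 < t) (hG : HasSum (fun k => c k * Real.exp (-(t * l k))) (G t)) : G t < 1 := by
  have h : ∀ k, c k * Real.exp (-(t * l k)) < c k := fun k => by
    refine mul_lt_of_lt_one_right (hc k) (Real.exp_lt_one_iff.2 ?_)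
    have := mul_pos ht (hl k)
    linarith
  exact hasSum_lt (fun k => (h k).le) (h 0) hG hc1

/-- Jensen's inequality for a Laplace transform. -/
lemma exp_neg_mean_le_laplace (hc : ∀ k, 0 < c k) (hc1 : HasSum c 1) {M : ℝ}
    (hM : HasSum (fun k => c k * l k) M) {t : ℝ}
    (hG : HasSum (fun k => c k * Real.exp (-(t * l k))) (G t)) : Real.exp (-(t * M)) ≤ G t := by
  have h := ((hc1.mul_right (1 + t * M)).sub (hM.mul_left t)).mul_left (Real.exp (-(t * M)))
  rw [show Real.exp (-(t * M)) * (1 * (1 + t * M) - t * M) = Real.exp (-(t * M)) by ring] at h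
  refine hasSum_le (fun k => ?_) h hG
  have h1 := Real.add_one_le_exp (t * M - t * l k)
  have h2 : Real.exp (-(t * l k)) = Real.exp (-(t * M)) * Real.exp (t * M - t * l k) := by
    rw [← Real.exp_add]; ring_nf
  rw [h2]
  have h3 := mul_le_mul_of_nonneg_left h1 (mul_pos (hc k) (Real.exp_pos (-(t * M)))).le
  linarith

lemma mean_mul_le_one_sub_laplace (hc : ∀ k, 0 < c k) (hc1 : HasSum c 1) (hl : ∀ k, 0 < l k)
    (hL : ∀ k, l k ≤ L) {M : ℝ} (hM : HasSum (fun k => c k * l k) M) {t : ℝ}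
    (hG : HasSum (fun k => c k * Real.exp (-(t * l k))) (G t)) :
    M / L * (1 - Real.exp (-(t * L))) ≤ 1 - G t := by
  have hL0 : 0 < L := (hl 0).trans_le (hL 0)
  rw [div_mul_eq_mul_div, mul_div_assoc]
  refine hasSum_le (fun k => ?_) (hM.mul_right _) (hc1.sub hG)
  have h := exp_mul_le_affine (div_nonneg (hl k).le hL0.le) ((div_le_one hL0).2 (hL k)) (-(t * L))
  rw [show l k / L * -(t * L) = -(t * l k) by field_simp] at h
  have h' := mul_le_mul_of_nonneg_left h (hc k).le
  have e : c k * l k * ((1 - Real.exp (-(t * L))) / L) =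
      c k * (l k / L) * (1 - Real.exp (-(t * L))) := by ring
  rw [e]
  linarith

lemma exp_mul_one_sub_le_of_mean (hc : ∀ k, 0 < c k) (hc1 : HasSum c 1) (hl : ∀ k, 0 < l k)
    (hL : ∀ k, l k ≤ L) {M : ℝ} (hM : HasSum (fun k => c k * l k) M) {t P : ℝ}
    (hG : HasSum (fun k => c k * Real.exp (-(t * l k))) (G t)) (hP : Real.exp (-(t * M)) ≤ P) :
    Real.exp (-(t * L)) * (1 - P) ≤ P * (1 - G t) := by
  have hL0 : 0 < L := (hl 0).trans_le (hL 0)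
  have hM0 : 0 ≤ M := hM.nonneg fun k => (mul_pos (hc k) (hl k)).le
  have hML : M ≤ L := by
    refine hasSum_le (fun k => ?_) hM (by simpa using hc1.mul_right L)
    exact mul_le_mul_of_nonneg_left (hL k) (hc k).le
  have h1 := mean_mul_le_one_sub_laplace hc hc1 hl hL hM hG
  have h2 := exp_mul_le_affine (sub_nonneg.2 ((div_le_one hL0).2 hML))
    (sub_le_self 1 (div_nonneg hM0 hL0.le)) (-(t * L))
  have h3 : Real.exp (-(t * L)) = Real.exp (-(t * M)) * Real.exp ((1 - M / L) * -(t * L)) := by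
    rw [← Real.exp_add]
    congr 1
    field_simp
    ring
  have h4 : Real.exp ((1 - M / L) * -(t * L)) ≤ 1 - G t + Real.exp (-(t * L)) := by linarith
  have h5 := mul_le_mul hP h4 (Real.exp_pos _).le ((Real.exp_pos _).le.trans hP)
  rw [← h3] at h5
  linarith

lemma laplace_sub_ge (hc : ∀ k, 0 < c k) (hc1 : HasSum c 1) (hl : ∀ k, 0 < l k)
    (hL : ∀ k, l k ≤ L) (hG : ∀ t, 0 < t → HasSum (fun k => c k * Real.exp (-(t * l k))) (G t))
    {s t : ℝ} (hs : 0 < s) (ht : 0 < t) :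
    Real.exp (-(s * L)) * (1 - G t) ≤ G s - G (t + s) := by
  refine hasSum_le (fun k => ?_) ((hc1.sub (hG t ht)).mul_left _)
    ((hG s hs).sub (hG (t + s) (by positivity)))
  rw [show -((t + s) * l k) = -(s * l k) + -(t * l k) by ring, Real.exp_add]
  have h1 : Real.exp (-(s * L)) ≤ Real.exp (-(s * l k)) :=
    Real.exp_le_exp.2 (neg_le_neg (mul_le_mul_of_nonneg_left (hL k) hs.le))
  have h2 : Real.exp (-(t * l k)) ≤ 1 :=
    Real.exp_le_one_iff.2 (neg_nonpos.2 (mul_pos ht (hl k)).le)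
  have h3 := mul_le_mul_of_nonneg_right h1 (mul_nonneg (hc k).le (sub_nonneg.2 h2))
  linarith

lemma one_sub_prod_mul_exp_lt (hc : ∀ k, 0 < c k) (hc1 : HasSum c 1) (hl : ∀ k, 0 < l k)
    {L₀ : ℝ} (hL₀ : ∀ k, l k ≤ L₀) (hL : L₀ < L)
    (hG : ∀ t, 0 < t → HasSum (fun k => c k * Real.exp (-(t * l k))) (G t))
    {ι : Type*} [Fintype ι] [Nonempty ι] {t : ι → ℝ} (ht : ∀ i, 0 < t i) {s : ℝ} (hs : 0 < s) :
    (1 - ∏ i, G (t i)) * Real.exp (-((∑ i, t i + s) * L)) <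
      (∏ i, G (t i)) * (G s - G (∑ i, t i + s)) := by
  have hS : 0 < ∑ i, t i := Finset.sum_pos (fun i _ => ht i) Finset.univ_nonempty
  set S := ∑ i, t i
  set P := ∏ i, G (t i)
  have hP0 : 0 < P := Finset.prod_pos fun i _ => laplace_pos hc (hG _ (ht i))
  have hP1 : P < 1 := by
    obtain ⟨i⟩ := ‹Nonempty ι›
    have := Finset.prod_lt_prod (s := Finset.univ) (f := fun i => G (t i)) (g := fun _ => 1)
      (fun j _ => laplace_pos hc (hG _ (ht j)))
      (fun j _ => (laplace_lt_one hc hc1 hl (ht j) (hG _ (ht j))).le)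
      ⟨i, Finset.mem_univ i, laplace_lt_one hc hc1 hl (ht i) (hG _ (ht i))⟩
    simpa using this
  have hsum : Summable fun k => c k * l k :=
    Summable.of_nonneg_of_le (fun k => (mul_pos (hc k) (hl k)).le)
      (fun k => mul_le_mul_of_nonneg_left (hL₀ k) (hc k).le) (hc1.summable.mul_right L₀)
  obtain ⟨M, hM⟩ := hsum
  have hPM : Real.exp (-(S * M)) ≤ P := by
    rw [Finset.sum_mul, ← Finset.sum_neg_distrib, Real.exp_sum]
    exact Finset.prod_le_prod (fun i _ => (Real.exp_pos _).le)
      fun i _ => exp_neg_mean_le_laplace hc hc1 hM (hG _ (ht i))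
  have h1 := exp_mul_one_sub_le_of_mean hc hc1 hl (fun k => (hL₀ k).trans hL.le) hM (hG S hS) hPM
  have h2 := laplace_sub_ge hc hc1 hl hL₀ hG hs hS
  have hexp : Real.exp (-(s * L)) < Real.exp (-(s * L₀)) :=
    Real.exp_lt_exp.2 (neg_lt_neg (mul_lt_mul_of_pos_left hL hs))
  have hpos : 0 < Real.exp (-(S * L)) * (1 - P) := mul_pos (Real.exp_pos _) (sub_pos.2 hP1)
  calc (1 - P) * Real.exp (-((S + s) * L))
      = Real.exp (-(s * L)) * (Real.exp (-(S * L)) * (1 - P)) := by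
        rw [show -((S + s) * L) = -(s * L) + -(S * L) by ring, Real.exp_add]; ring
    _ < Real.exp (-(s * L₀)) * (Real.exp (-(S * L)) * (1 - P)) :=
        mul_lt_mul_of_pos_right hexp hpos
    _ ≤ Real.exp (-(s * L₀)) * (P * (1 - G S)) :=
        mul_le_mul_of_nonneg_left h1 (Real.exp_pos _).le
    _ = P * (Real.exp (-(s * L₀)) * (1 - G S)) := by ring
    _ ≤ P * (G s - G (S + s)) := mul_le_mul_of_nonneg_left h2 hP0.le

end Laplace

/-- A lower bound for a sum of increments weighted by an antitone nonnegative sequence. -/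
lemma neg_mul_le_sum_antitone_mul_sub {D f : ℕ → ℝ} (hD : Antitone D) (hf : ∀ k, 0 ≤ f k)
    (hD0 : ∀ k, 0 ≤ D k) (N : ℕ) :
    -(D 0 * f 0) ≤ ∑ k ∈ Finset.range N, D k * (f (k + 1) - f k) := by
  suffices h : D N * f N - D 0 * f 0 ≤ ∑ k ∈ Finset.range N, D k * (f (k + 1) - f k) by
    have := mul_nonneg (hD0 N) (hf N)
    linarith
  induction N with
  | zero => simp
  | succ N ih =>
    rw [Finset.sum_range_succ]
    have := mul_le_mul_of_nonneg_right (hD N.le_succ) (hf (N + 1))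
    linarith

section Iterated

variable {p : ℕ} [Fact p.Prime] {σ b : ℝ}

lemma indicator_padicBall_comp_sub (g : ℚ_[p] → ℝ) (c x₀ : ℚ_[p]) (r : ℤ) :
    (padicBall p c r).indicator (fun x => g (x - x₀)) =
      fun x => (padicBall p (c - x₀) r).indicator g (x - x₀) := by
  ext x
  simp only [Set.indicator_apply, padicBall, Set.mem_ofPred_eq, sub_sub_sub_cancel_right]

lemma padicBall_neg_eq {x₀ : ℚ_[p]} {r : ℤ} (hx : x₀ ∈ padicBall p 0 r) :
    padicBall p (0 - x₀) r = padicBall p 0 r := by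
  apply padicBall_eq_of_mem
  simpa using hx

lemma sub_mem_padicBall {x y : ℚ_[p]} {r : ℤ} (hx : x ∈ padicBall p 0 r)
    (hy : y ∈ padicBall p 0 r) : y - x ∈ padicBall p 0 r := by
  rw [← padicBall_eq_of_mem hx] at hy
  simpa using hy

lemma rho_mul_ballDensity (t : ℝ) (s : ℤ) (x x₀ y : ℚ_[p]) :
    rho p σ b t (x - x₀) * ballDensity p s (y - x) =
      (p : ℝ) ^ s * (padicBall p y (-s)).indicator (fun x => rho p σ b t (x - x₀)) x := by
  have h : y - x ∈ padicBall p 0 (-s) ↔ x ∈ padicBall p y (-s) := by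
    simp [norm_sub_rev]
  by_cases hx : x ∈ padicBall p y (-s)
  · rw [ballDensity_of_mem (h.2 hx), Set.indicator_of_mem hx, mul_comm]
  · rw [ballDensity_of_notMem (mt h.1 hx), Set.indicator_of_notMem hx, mul_zero, mul_zero]

lemma le_of_padicBall_subset {y : ℚ_[p]} {s a : ℤ}
    (h : padicBall p y s ⊆ padicBall p 0 a) (hy : y ∈ padicBall p 0 a) : s ≤ a := by
  have hz : (p : ℚ_[p]) ^ (-s) + y ∈ padicBall p y s := by simp
  have := sub_mem_padicBall hy (h hz)
  simpa [zpow_le_zpow_iff_right₀ (one_lt_cast_prime p)] using this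

variable [MeasurableSpace ℚ_[p]] [BorelSpace ℚ_[p]]
  {μ : Measure ℚ_[p]} [μ.IsAddHaarMeasure]

lemma setIntegral_padicBall_comp_sub (g : ℚ_[p] → ℝ) (c x₀ : ℚ_[p]) (r : ℤ) :
    ∫ x in padicBall p c r, g (x - x₀) ∂μ = ∫ z in padicBall p (c - x₀) r, g z ∂μ := by
  rw [← integral_indicator (measurableSet_padicBall _ _), indicator_padicBall_comp_sub,
    integral_sub_right_eq_self, integral_indicator (measurableSet_padicBall _ _)]

lemma integrableOn_padicBall_comp_sub {g : ℚ_[p] → ℝ} {c x₀ : ℚ_[p]} {r : ℤ}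
    (hg : IntegrableOn g (padicBall p (c - x₀) r) μ) :
    IntegrableOn (fun x => g (x - x₀)) (padicBall p c r) μ := by
  rw [← integrable_indicator_iff (measurableSet_padicBall _ _)] at hg ⊢
  rw [indicator_padicBall_comp_sub]
  exact hg.comp_sub_right x₀

lemma setIntegral_rho_mul_ballDensity (t : ℝ) {r s : ℤ} (hrs : r ≤ s) {y : ℚ_[p]}
    (hy : y ∈ padicBall p 0 (-r)) (x₀ : ℚ_[p]) :
    ∫ x in padicBall p 0 (-r), rho p σ b t (x - x₀) * ballDensity p s (y - x) ∂μ =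
      rhoAverage σ b μ t s (y - x₀) := by
  simp_rw [rho_mul_ballDensity]
  rw [integral_const_mul, setIntegral_indicator (measurableSet_padicBall _ _),
    ← padicBall_eq_of_mem hy, Set.inter_eq_right.2 (padicBall_subset (by lia) y),
    setIntegral_padicBall_comp_sub, rhoAverage]

lemma integrableOn_rho_comp_sub (hμ : μ (padicBall p 0 0) = 1) (hσ : 0 < σ) (hb : 0 < b) {t : ℝ}
    (ht : 0 < t) {r : ℤ} {x₀ : ℚ_[p]} (hx : x₀ ∈ padicBall p 0 (-r)) :
    IntegrableOn (fun x => rho p σ b t (x - x₀)) (padicBall p 0 (-r)) μ := by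
  apply integrableOn_padicBall_comp_sub
  rw [padicBall_neg_eq hx]
  exact integrableOn_rho hμ hσ hb ht r

lemma integrableOn_rho_mul_ballDensity (hμ : μ (padicBall p 0 0) = 1) (hσ : 0 < σ) (hb : 0 < b)
    {t : ℝ} (ht : 0 < t) {r : ℤ} {x₀ : ℚ_[p]} (hx : x₀ ∈ padicBall p 0 (-r)) (s : ℤ) (y : ℚ_[p]) :
    IntegrableOn (fun x => rho p σ b t (x - x₀) * ballDensity p s (y - x))
      (padicBall p 0 (-r)) μ := by
  simp_rw [rho_mul_ballDensity]
  refine Integrable.const_mul ?_ _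
  exact (integrableOn_rho_comp_sub hμ hσ hb ht hx).indicator (measurableSet_padicBall _ _)

/-- The kernel `rho p σ b t` restricted to `B_{-r}` acts diagonally on constants and on the
differences of consecutive uniform densities. -/
lemma setIntegral_rho_mul_combination (hμ : μ (padicBall p 0 0) = 1) (hσ : 0 < σ) (hb : 0 < b)
    {t : ℝ} (ht : 0 < t) {r : ℤ} {x₀ y : ℚ_[p]} (hx : x₀ ∈ padicBall p 0 (-r))
    (hy : y ∈ padicBall p 0 (-r)) (α : ℝ) (β : ℕ → ℝ) (N : ℕ) :
    ∫ x in padicBall p 0 (-r), rho p σ b t (x - x₀) * (α + ∑ k ∈ Finset.range N,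
        β k * (ballDensity p (r + k + 1) (y - x) - ballDensity p (r + k) (y - x))) ∂μ =
      α * rhoMass σ b μ t r + ∑ k ∈ Finset.range N, β k * (decay p σ b t (r + k + 1) *
        (ballDensity p (r + k + 1) (y - x₀) - ballDensity p (r + k) (y - x₀))) := by
  have hi := integrableOn_rho_mul_ballDensity hμ hσ hb ht hx (y := y)
  have hk : ∀ k : ℕ, IntegrableOn (fun x => β k * (rho p σ b t (x - x₀) *
      ballDensity p (r + k + 1) (y - x) - rho p σ b t (x - x₀) * ballDensity p (r + k) (y - x)))
      (padicBall p 0 (-r)) μ := fun k => ((hi _).sub (hi _)).const_mul (β k)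
  have hmass : ∫ x in padicBall p 0 (-r), rho p σ b t (x - x₀) ∂μ = rhoMass σ b μ t r := by
    rw [setIntegral_padicBall_comp_sub, padicBall_neg_eq hx, rhoMass]
  have hsplit : ∀ x, rho p σ b t (x - x₀) * (α + ∑ k ∈ Finset.range N,
        β k * (ballDensity p (r + k + 1) (y - x) - ballDensity p (r + k) (y - x))) =
      α * rho p σ b t (x - x₀) + ∑ k ∈ Finset.range N, β k * (rho p σ b t (x - x₀) *
        ballDensity p (r + k + 1) (y - x) -
          rho p σ b t (x - x₀) * ballDensity p (r + k) (y - x)) := fun x => by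
    rw [mul_add, Finset.mul_sum]
    congr 1
    · ring
    · exact Finset.sum_congr rfl fun k _ => by ring
  simp_rw [hsplit]
  rw [integral_add ((integrableOn_rho_comp_sub hμ hσ hb ht hx).const_mul α)
    (integrable_finsetSum _ fun k _ => hk k), integral_const_mul, hmass,
    integral_finsetSum _ fun k _ => hk k]
  congr 1
  refine Finset.sum_congr rfl fun k _ => ?_
  rw [integral_const_mul, integral_sub (hi _) (hi _),
    setIntegral_rho_mul_ballDensity t (by lia) hy, setIntegral_rho_mul_ballDensity t (by lia) hy,
    rhoAverage_sub hμ hσ hb ht]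

lemma iterInt_combination (hμ : μ (padicBall p 0 0) = 1) (hσ : 0 < σ) (hb : 0 < b) {r : ℤ}
    {y : ℚ_[p]} (hy : y ∈ padicBall p 0 (-r)) {f : ℚ_[p] → ℝ} {α : ℝ} {β : ℕ → ℝ} {N : ℕ}
    (hf : ∀ x ∈ padicBall p 0 (-r), f x = α + ∑ k ∈ Finset.range N,
      β k * (ballDensity p (r + k + 1) (y - x) - ballDensity p (r + k) (y - x)))
    {ts : List ℝ} (hts : ∀ t ∈ ts, 0 < t) {x₀ : ℚ_[p]} (hx : x₀ ∈ padicBall p 0 (-r)) :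
    iterInt p σ b μ (padicBall p 0 (-r)) f ts x₀ =
      (ts.map fun t => rhoMass σ b μ t r).prod * α + ∑ k ∈ Finset.range N,
        (decay p σ b ts.sum (r + k + 1) * β k) *
          (ballDensity p (r + k + 1) (y - x₀) - ballDensity p (r + k) (y - x₀)) := by
  induction ts generalizing x₀ with
  | nil => simp [iterInt, hf x₀ hx, decay]
  | cons t ts ih =>
    have ht : 0 < t := hts t List.mem_cons_self
    rw [iterInt, setIntegral_congr_fun (measurableSet_padicBall _ _) fun x hx' => by
        simp only [ih (fun s hs => hts s (List.mem_cons_of_mem _ hs)) hx']; rfl,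
      setIntegral_rho_mul_combination hμ hσ hb ht hx hy]
    rw [List.map_cons, List.prod_cons, List.sum_cons]
    congr 1
    · ring
    · refine Finset.sum_congr rfl fun k _ => ?_
      rw [decay_add]
      ring

lemma setIntegral_padicBall_rho (hμ : μ (padicBall p 0 0) = 1) (hσ : 0 < σ) (hb : 0 < b) {t : ℝ}
    (ht : 0 < t) {r : ℤ} (N : ℕ) {c : ℚ_[p]} (hc : c ∈ padicBall p 0 (-r)) :
    (p : ℝ) ^ (r + N) * ∫ z in padicBall p c (-(r + N)), rho p σ b t z ∂μ =
      (p : ℝ) ^ r * rhoMass σ b μ t r + ∑ k ∈ Finset.range N, decay p σ b t (r + k + 1) *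
        (ballDensity p (r + k + 1) c - ballDensity p (r + k) c) := by
  change rhoAverage σ b μ t (r + N) c = rhoAverage σ b μ t r 0 + _
  rw [← rhoAverage_of_mem hc, ← sub_eq_iff_eq_add']
  have h := Finset.sum_range_sub (fun k : ℕ => rhoAverage σ b μ t (r + k) c) N
  simp only [Nat.cast_zero, add_zero] at h
  rw [← h]
  refine Finset.sum_congr rfl fun k _ => ?_
  rw [← rhoAverage_sub hμ hσ hb ht]
  push_cast
  rw [add_assoc]

lemma one_sub_prod_rhoMass_mul_decay_lt (hμ : μ (padicBall p 0 0) = 1) (hσ : 0 < σ) (hb : 0 < b)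
    (r : ℤ) {ι : Type*} [Fintype ι] [Nonempty ι] {t : ι → ℝ} (ht : ∀ i, 0 < t i) {s : ℝ}
    (hs : 0 < s) :
    (1 - ∏ i, rhoMass σ b μ (t i) r) * decay p σ b (∑ i, t i + s) (r + 1) <
      (∏ i, rhoMass σ b μ (t i) r) * (rhoMass σ b μ s r - rhoMass σ b μ (∑ i, t i + s) r) := by
  have hp := one_lt_cast_prime p
  have hq1 : (p : ℝ)⁻¹ < 1 := inv_lt_one_of_one_lt₀ hp
  have hq0 : 0 < (p : ℝ)⁻¹ := by positivity
  have hdecay : ∀ (u : ℝ) (k : ℤ),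
      decay p σ b u k = Real.exp (-(u * (σ * (p : ℝ) ^ ((k : ℝ) * b)))) := fun u k => by
    rw [decay]; ring_nf
  rw [hdecay]
  refine one_sub_prod_mul_exp_lt (c := fun k => (1 - (p : ℝ)⁻¹) * (p : ℝ)⁻¹ ^ k)
    (l := fun k => σ * (p : ℝ) ^ (((r - k : ℤ) : ℝ) * b))
    (L₀ := σ * (p : ℝ) ^ ((r : ℝ) * b)) (G := fun u => rhoMass σ b μ u r)
    (fun k => ?_) ?_ (fun k => by positivity) (fun k => ?_) ?_ (fun u hu => ?_) ht hs
  · have : 0 < 1 - (p : ℝ)⁻¹ := by linarith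
    positivity
  · have := (hasSum_geometric_of_lt_one hq0.le hq1).mul_left (1 - (p : ℝ)⁻¹)
    rwa [mul_inv_cancel₀ (by linarith)] at this
  · gcongr
    · exact hp.le
    · lia
  · gcongr σ * ?_
    refine Real.rpow_lt_rpow_of_exponent_lt hp (mul_lt_mul_of_pos_right ?_ hb)
    exact_mod_cast lt_add_one r
  · simp_rw [← hdecay]
    exact hasSum_rhoMass hμ hσ hb hu r

end Iterated

/-- Let `m ≥ 1`, `a ∈ ℤ`, `y ∈ B_a`, and let `n` be large enough that the
ball `B_{−n}(y) = {z : |z−y| ≤ p^{−n}}` is contained in `B_a`.  Then for all positive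
reals `t_1,…,t_{m+1}` (with `z_0 := 0`):
`∫_{B_a}⋯∫_{B_a}∫_{B_{−n}(y)} ρ(t_{m+1}, z−z_m) ∏_{i=1}^m ρ(t_i, z_i−z_{i−1})
   dμ(z) dμ(z_m)⋯dμ(z_1)
 > (∫_{B_{−n}(y)} ρ(t_1+⋯+t_{m+1}, z) dμ(z)) · ∏_{i=1}^m ∫_{B_a} ρ(t_i, z_i) dμ(z_i)`. -/
theorem exit_prob_statement_16 (p : ℕ) [Fact p.Prime]
    [MeasurableSpace ℚ_[p]] [BorelSpace ℚ_[p]]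
    (μ : Measure ℚ_[p]) [μ.IsAddHaarMeasure]
    (hμ : μ {x : ℚ_[p] | ‖x‖ ≤ 1} = 1)
    (σ b : ℝ) (hσ : 0 < σ) (hb : 0 < b)
    (m : ℕ) (hm : 1 ≤ m) (a : ℤ) (y : ℚ_[p]) (hy : ‖y‖ ≤ (p : ℝ) ^ a)
    (n : ℕ)
    (hn : {z : ℚ_[p] | ‖z - y‖ ≤ (p : ℝ) ^ (-(n : ℤ))} ⊆ {x : ℚ_[p] | ‖x‖ ≤ (p : ℝ) ^ a})
    (t : Fin (m + 1) → ℝ) (ht : ∀ i, 0 < t i) :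
    iterInt p σ b μ {x : ℚ_[p] | ‖x‖ ≤ (p : ℝ) ^ a}
        (fun x0 => ∫ z in {z : ℚ_[p] | ‖z - y‖ ≤ (p : ℝ) ^ (-(n : ℤ))},
          rho p σ b (t (Fin.last m)) (z - x0) ∂μ)
        (List.ofFn fun i : Fin m => t i.castSucc) 0 >
      (∫ z in {z : ℚ_[p] | ‖z - y‖ ≤ (p : ℝ) ^ (-(n : ℤ))},
          rho p σ b (∑ i, t i) z ∂μ) *
        ∏ i : Fin m,
          ∫ x in {x : ℚ_[p] | ‖x‖ ≤ (p : ℝ) ^ a}, rho p σ b (t i.castSucc) x ∂μ := by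
  have hp := one_lt_cast_prime p
  have : Nonempty (Fin m) := ⟨⟨0, hm⟩⟩
  have hball : ∀ r : ℤ, {x : ℚ_[p] | ‖x‖ ≤ (p : ℝ) ^ r} = padicBall p 0 r := fun r => by
    simp [padicBall]
  have hμ' : μ (padicBall p 0 0) = 1 := by
    rw [← hball, zpow_zero]
    exact hμ
  obtain ⟨r, rfl⟩ : ∃ r : ℤ, a = -r := ⟨-a, by simp⟩
  rw [hball] at hn ⊢
  have hy' : y ∈ padicBall p 0 (-r) := by
    rw [← hball]
    exact hy
  obtain ⟨N, hN⟩ : ∃ N : ℕ, (n : ℤ) = r + N :=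
    ⟨(n - r).toNat, by have := le_of_padicBall_subset hn hy'; lia⟩
  rw [hN]
  have hq : (0 : ℝ) < (p : ℝ) ^ (r + N) := by positivity
  have hpr : (0 : ℝ) < (p : ℝ) ^ r := by positivity
  set s := t (Fin.last m) with hs
  have hs0 : 0 < s := ht _
  have hi0 : ∀ i : Fin m, 0 < t i.castSucc := fun i => ht _
  have hsum : ∑ i, t i = ∑ i : Fin m, t i.castSucc + s := Fin.sum_univ_castSucc t
  have hT : 0 < ∑ i, t i := Finset.sum_pos (fun i _ => ht i) Finset.univ_nonempty
  have hf : ∀ x ∈ padicBall p 0 (-r),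
      ∫ z in padicBall p y (-(r + N)), rho p σ b s (z - x) ∂μ =
        ((p : ℝ) ^ (r + N))⁻¹ * ((p : ℝ) ^ r * rhoMass σ b μ s r) + ∑ k ∈ Finset.range N,
          (((p : ℝ) ^ (r + N))⁻¹ * decay p σ b s (r + k + 1)) *
            (ballDensity p (r + k + 1) (y - x) - ballDensity p (r + k) (y - x)) := by
    intro x hx
    have h := setIntegral_padicBall_rho hμ' hσ hb hs0 N (sub_mem_padicBall hx hy')
    rw [← eq_inv_mul_iff_mul_eq₀ hq.ne'] at h
    rw [setIntegral_padicBall_comp_sub, h, mul_add, Finset.mul_sum]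
    simp only [mul_assoc]
  have hleft := iterInt_combination hμ' hσ hb hy' hf
    (ts := List.ofFn fun i : Fin m => t i.castSucc)
    (by simpa [List.mem_ofFn] using hi0) (zero_mem_padicBall _)
  have hright := setIntegral_padicBall_rho hμ' hσ hb hT N hy'
  have hstrict := one_sub_prod_rhoMass_mul_decay_lt hμ' hσ hb r hi0 hs0
  rw [List.map_ofFn, List.prod_ofFn, List.sum_ofFn] at hleft
  simp only [Function.comp_apply, sub_zero] at hleft
  rw [← hsum] at hstrict
  have hP1 : ∏ i : Fin m, rhoMass σ b μ (t i.castSucc) r ≤ 1 :=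
    Finset.prod_le_one (fun i _ => rhoMass_nonneg _ hσ hb (hi0 i) r)
      fun i _ => rhoMass_le_one hμ' hσ hb (hi0 i) r
  have habel := neg_mul_le_sum_antitone_mul_sub
    (D := fun k : ℕ => decay p σ b (∑ i, t i) (r + k + 1))
    (f := fun k : ℕ => ballDensity p (r + k) y)
    (fun i j hij => decay_antitone hσ hb hT (by lia)) (fun k => ballDensity_nonneg _ _)
    (fun k => (Real.exp_pos _).le) N
  simp only [Nat.cast_zero, add_zero, ballDensity_of_mem hy', Nat.cast_add, Nat.cast_one,
    ← add_assoc] at habel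
  change _ > _ * ∏ i : Fin m, rhoMass σ b μ (t i.castSucc) r
  rw [gt_iff_lt, ← mul_lt_mul_iff_right₀ hq, ← mul_assoc, hright, hleft]
  set P := ∏ i : Fin m, rhoMass σ b μ (t i.castSucc) r
  set Y := ∑ k ∈ Finset.range N, decay p σ b (∑ i, t i) (r + k + 1) *
    (ballDensity p (r + k + 1) y - ballDensity p (r + k) y) with hY
  have hsumY : (p : ℝ) ^ (r + (N : ℤ)) * ∑ k ∈ Finset.range N,
      decay p σ b (∑ i : Fin m, t i.castSucc) (r + k + 1) *
        (((p : ℝ) ^ (r + (N : ℤ)))⁻¹ * decay p σ b s (r + k + 1)) *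
        (ballDensity p (r + k + 1) y - ballDensity p (r + k) y) = Y := by
    rw [hY, Finset.mul_sum]
    refine Finset.sum_congr rfl fun k _ => ?_
    rw [hsum, decay_add]
    field_simp
  have hmass : (p : ℝ) ^ (r + (N : ℤ)) *
      (P * (((p : ℝ) ^ (r + (N : ℤ)))⁻¹ * ((p : ℝ) ^ r * rhoMass σ b μ s r))) =
        P * ((p : ℝ) ^ r * rhoMass σ b μ s r) := by
    field_simp
  rw [mul_add, hsumY, hmass]
  have h1 := mul_le_mul_of_nonneg_left habel (sub_nonneg.2 hP1)
  have h2 := mul_lt_mul_of_pos_right hstrict hpr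
  linarith
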